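/- Let X be a self-adjoint complex n×n matrix. Then there exist a positive semidefinite n×n matrix G with ‖G‖_c ≤ 1 and a self-adjoint n×n matrix S such that S² equals the orthogonal projection onto the range of G (so S is a self-adjoint partial isometry whose support is the range of G) and X = ‖X‖_S · G S G. -/

import Mathlib

open Matrix
open scoped ComplexOrder

noncomputable section

namespace MatFact

/-- ℓ² norm of a complex vector. -/
def vnorm {n : ℕ} (v : Fin n → ℂ) : ℝ := Real.sqrt (∑ j, ‖v j‖ ^ 2)

/-- Operator norm of a matrix as a map ℓ²(Fin n) → ℓ²(Fin m). -/
def opNorm {m n : ℕ} (X : Matrix (Fin m) (Fin n) ℂ) : ℝ :=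
  sSup {c : ℝ | ∃ v : Fin n → ℂ, vnorm v ≤ 1 ∧ c = vnorm (X.mulVec v)}

/-- Column norm: the maximal ℓ² norm of a column. -/
def colNorm {m n : ℕ} (X : Matrix (Fin m) (Fin n) ℂ) : ℝ :=
  ⨆ j : Fin n, vnorm (fun i => X i j)

/-- Hilbert–Schmidt (Frobenius) norm. -/
def frobNorm {m n : ℕ} (X : Matrix (Fin m) (Fin n) ℂ) : ℝ :=
  Real.sqrt (∑ i, ∑ j, ‖X i j‖ ^ 2)

/-- Schur norm: operator norm of Schur (entrywise) multiplication by `X`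
on matrices with the operator norm. -/
def schurNorm {m n : ℕ} (X : Matrix (Fin m) (Fin n) ℂ) : ℝ :=
  sSup {c : ℝ | ∃ A : Matrix (Fin m) (Fin n) ℂ, opNorm A ≤ 1 ∧
    c = opNorm (Matrix.hadamard X A)}

/-- The T-norm (bilinear Schur norm). -/
def Tnorm {m n : ℕ} (X : Matrix (Fin m) (Fin n) ℂ) : ℝ :=
  sSup {c : ℝ | ∃ (a : Fin m → ℂ) (B : Matrix (Fin m) (Fin n) ℂ),
    (∀ i, ‖a i‖ ≤ 1) ∧ opNorm B ≤ 1 ∧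
    c = vnorm (fun j => ∑ i, a i * X i j * B i j)}

/-- The F-norm: operator norm of `X` from `ℂⁿ` with the sup norm to `ℂᵐ`
with the ℓ² norm. -/
def Fnorm {m n : ℕ} (X : Matrix (Fin m) (Fin n) ℂ) : ℝ :=
  sSup {c : ℝ | ∃ v : Fin n → ℂ, (∀ j, ‖v j‖ ≤ 1) ∧ c = vnorm (X.mulVec v)}

/-- The bilinear form norm. -/
def Bnorm {m n : ℕ} (Y : Matrix (Fin m) (Fin n) ℂ) : ℝ :=
  sSup {c : ℝ | ∃ (a : Fin m → ℂ) (b : Fin n → ℂ), (∀ i, ‖a i‖ ≤ 1) ∧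
    (∀ j, ‖b j‖ ≤ 1) ∧ c = ‖∑ i, ∑ j, Y i j * a i * b j‖}

/-- The completely bounded F-norm. -/
def cbF {m n : ℕ} (X : Matrix (Fin m) (Fin n) ℂ) : ℝ :=
  sInf {c : ℝ | ∃ (A : Matrix (Fin m) (Fin n) ℂ) (ξ : Fin n → ℂ),
    X = A * Matrix.diagonal ξ ∧ c = opNorm A * vnorm ξ}

/-- The completely bounded bilinear form norm. -/
def cbB {m n : ℕ} (X : Matrix (Fin m) (Fin n) ℂ) : ℝ :=
  sInf {c : ℝ | ∃ (η : Fin m → ℂ) (B : Matrix (Fin m) (Fin n) ℂ) (ξ : Fin n → ℂ),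
    X = Matrix.diagonal η * B * Matrix.diagonal ξ ∧
    c = vnorm η * opNorm B * vnorm ξ}

/-- The range (column space) of a matrix, as a submodule of `ℂᵐ`. -/
def ran {m n : ℕ} (X : Matrix (Fin m) (Fin n) ℂ) : Submodule ℂ (Fin m → ℂ) :=
  LinearMap.range X.mulVecLin

/-- `P` is the orthogonal projection onto the subspace `E`, i.e. `P` is a
Hermitian idempotent with range `E`. -/
def IsOrthProjOnto {n : ℕ} (P : Matrix (Fin n) (Fin n) ℂ)
    (E : Submodule ℂ (Fin n → ℂ)) : Prop :=
  P.IsHermitian ∧ P * P = P ∧ ran P = E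

/-- `W` is a partial isometry with support `E` and range `F`. -/
def IsPartialIsometryFromTo {m n : ℕ} (W : Matrix (Fin m) (Fin n) ℂ)
    (E : Submodule ℂ (Fin n → ℂ)) (F : Submodule ℂ (Fin m → ℂ)) : Prop :=
  IsOrthProjOnto (Wᴴ * W) E ∧ IsOrthProjOnto (W * Wᴴ) F

/-- A cb operator factorization of `X`. -/
def IsCbOpFact {m n : ℕ} (X A : Matrix (Fin m) (Fin n) ℂ) (ξ : Fin n → ℂ) : Prop :=
  (∀ j, 0 ≤ ξ j) ∧ vnorm ξ = 1 ∧ opNorm A = cbF X ∧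
  (∀ j, ξ j = 0 → ∀ i, A i j = 0) ∧ X = A * Matrix.diagonal ξ

/-- A cb bilinear form factorization of `X`. -/
def IsCbBilFact {m n : ℕ} (X : Matrix (Fin m) (Fin n) ℂ) (η : Fin m → ℂ)
    (B : Matrix (Fin m) (Fin n) ℂ) (ξ : Fin n → ℂ) : Prop :=
  (∀ i, 0 ≤ η i) ∧ (∀ j, 0 ≤ ξ j) ∧ vnorm η = 1 ∧ vnorm ξ = 1 ∧
  opNorm B = cbB X ∧ (∀ j, ξ j = 0 → ∀ i, B i j = 0) ∧
  (∀ i, η i = 0 → ∀ j, B i j = 0) ∧ X = Matrix.diagonal η * B * Matrix.diagonal ξ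

/-- A Schur factorization of `X`. -/
def IsSchurFact {m n : ℕ} (X : Matrix (Fin m) (Fin n) ℂ)
    (F : Matrix (Fin m) (Fin m) ℂ) (W : Matrix (Fin m) (Fin n) ℂ)
    (G : Matrix (Fin n) (Fin n) ℂ) : Prop :=
  F.PosSemidef ∧ (∀ i, (F * F) i i ≤ 1) ∧ G.PosSemidef ∧ (∀ j, (G * G) j j ≤ 1) ∧
  IsPartialIsometryFromTo W (ran G) (ran F) ∧
  X = (schurNorm X : ℂ) • (F * W * G)

/-- A bilinear Schur factorization of `X`. -/
def IsBilinSchurFact {m n : ℕ} (X : Matrix (Fin m) (Fin n) ℂ)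
    (T : Matrix (Fin m) (Fin m) ℂ) (W : Matrix (Fin m) (Fin n) ℂ)
    (G : Matrix (Fin n) (Fin n) ℂ) : Prop :=
  T.PosSemidef ∧ frobNorm T = Tnorm X ∧ G.PosSemidef ∧ (∀ j, (G * G) j j ≤ 1) ∧
  IsPartialIsometryFromTo W (ran G) (ran T) ∧ X = T * W * G

/-- Maximal diagonal entry (real part) of a square matrix. -/
def maxDiag {n : ℕ} (P : Matrix (Fin n) (Fin n) ℂ) : ℝ := ⨆ i, (P i i).re

end MatFact

namespace MatFact

variable {n : ℕ}

/-- A unitary diagonalization of a Hermitian matrix, stated with plain matrix products. -/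
lemma exists_unitary_diagonal {A : Matrix (Fin n) (Fin n) ℂ} (hA : A.IsHermitian) :
    ∃ Q : Matrix (Fin n) (Fin n) ℂ, Qᴴ * Q = 1 ∧ Q * Qᴴ = 1 ∧
      A = Q * diagonal (fun i => (hA.eigenvalues i : ℂ)) * Qᴴ := by
  refine ⟨hA.eigenvectorUnitary, ?_, ?_, ?_⟩
  · exact Unitary.coe_star_mul_self hA.eigenvectorUnitary
  · exact Unitary.coe_mul_star_self hA.eigenvectorUnitary
  · conv_lhs => rw [hA.spectral_theorem, Unitary.conjStarAlgAut_apply]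
    rfl

lemma conj_mul_conj {Q : Matrix (Fin n) (Fin n) ℂ} (hQ : Qᴴ * Q = 1)
    (A B : Matrix (Fin n) (Fin n) ℂ) : (Q * A * Qᴴ) * (Q * B * Qᴴ) = Q * (A * B) * Qᴴ := by
  calc (Q * A * Qᴴ) * (Q * B * Qᴴ) = Q * A * (Qᴴ * Q) * B * Qᴴ := by simp only [Matrix.mul_assoc]
    _ = _ := by rw [hQ]; simp only [Matrix.mul_assoc, Matrix.one_mul]

/-- A positive semidefinite matrix has a positive semidefinite square root together with a
Hermitian pseudo-inverse of that root. -/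
lemma exists_sqrt_pinv {P : Matrix (Fin n) (Fin n) ℂ} (hP : P.PosSemidef) :
    ∃ G M : Matrix (Fin n) (Fin n) ℂ, G.PosSemidef ∧ M.IsHermitian ∧ G * G = P ∧
      G * M = M * G ∧ G * M * G = G ∧ M * G * M = M := by
  obtain ⟨Q, hQ, -, hPQ⟩ := exists_unitary_diagonal hP.1
  set s : Fin n → ℝ := fun i => √(hP.1.eigenvalues i) with hs
  refine ⟨Q * diagonal (fun i => (s i : ℂ)) * Qᴴ, Q * diagonal (fun i => ((s i)⁻¹ : ℂ)) * Qᴴ,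
    ?_, ?_, ?_, ?_, ?_, ?_⟩
  · refine PosSemidef.mul_mul_conjTranspose_same (PosSemidef.diagonal fun i => ?_) Q
    exact Complex.zero_le_real.2 (Real.sqrt_nonneg _)
  · refine isHermitian_mul_mul_conjTranspose Q ?_
    refine isHermitian_diagonal_of_self_adjoint _ ?_
    ext i
    simp
  · conv_rhs => rw [hPQ]
    rw [conj_mul_conj hQ, diagonal_mul_diagonal]
    congr 3
    ext i
    rw [← Complex.ofReal_mul, Real.mul_self_sqrt (hP.eigenvalues_nonneg i)]
  · simp only [conj_mul_conj hQ, diagonal_mul_diagonal, mul_comm]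
  · simp only [conj_mul_conj hQ, diagonal_mul_diagonal]
    congr 3
    ext i
    exact mul_inv_mul_cancel _
  · simp only [conj_mul_conj hQ, diagonal_mul_diagonal]
    congr 3
    ext i
    rcases eq_or_ne (s i : ℂ) 0 with h | h
    · simp [h]
    · field_simp

lemma mul_eq_zero_of_conj_eq_zero {A N : Matrix (Fin n) (Fin n) ℂ} (hA : A.PosSemidef)
    (h : Nᴴ * A * N = 0) : A * N = 0 := by
  obtain ⟨G, -, hG, -, rfl, -⟩ := exists_sqrt_pinv hA
  have h1 : G * N = 0 := by
    rw [← conjTranspose_mul_self_eq_zero, conjTranspose_mul, hG.1.eq, ← h]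
    simp only [Matrix.mul_assoc]
  rw [Matrix.mul_assoc, h1, Matrix.mul_zero]

lemma add_eq_zero_left {A B : Matrix (Fin n) (Fin n) ℂ} (hA : A.PosSemidef)
    (hB : B.PosSemidef) (h : A + B = 0) : A = 0 := by
  rw [← hA.trace_eq_zero_iff]
  have h1 : A.trace + B.trace = 0 := by rw [← trace_add, h, trace_zero]
  exact ((add_eq_zero_iff_of_nonneg hA.trace_nonneg hB.trace_nonneg).1 h1).1

lemma posSemidef_of_majorant {X P : Matrix (Fin n) (Fin n) ℂ} (hp : (P + X).PosSemidef)
    (hm : (P - X).PosSemidef) : P.PosSemidef := by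
  have hhalf : (0 : ℂ) ≤ 1 / 2 := by
    rw [Complex.le_def]; norm_num
  have := (hp.add hm).smul hhalf
  convert this using 1
  module

/-- The algebraic core: a trace-minimal majorant `P` of `± X` yields the factorization of `X`. -/
lemma exists_symmetry_of_minimal {X P : Matrix (Fin n) (Fin n) ℂ} (hX : X.IsHermitian)
    (hA : (P + X).PosSemidef) (hB : (P - X).PosSemidef)
    (hmin : ∀ Q : Matrix (Fin n) (Fin n) ℂ, Q.PosSemidef → (P - Q + X).PosSemidef →
      (P - Q - X).PosSemidef → Q = 0) :
    ∃ G S : Matrix (Fin n) (Fin n) ℂ, G.PosSemidef ∧ G * G = P ∧ S.IsHermitian ∧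
      IsOrthProjOnto (S * S) (ran G) ∧ X = G * S * G := by
  have hhalf : (0 : ℂ) ≤ 1 / 2 := by
    rw [Complex.le_def]; norm_num
  obtain ⟨G, M, hG, hM, hGG, hcomm, hGMG, hMGM⟩ :=
    exists_sqrt_pinv (posSemidef_of_majorant hA hB)
  set E := G * M with hE
  have hEG : E * G = G := hGMG
  have hGE : G * E = G := by rw [hcomm, ← Matrix.mul_assoc, hGMG]
  have hME : M * E = M := by rw [hE, ← Matrix.mul_assoc, hMGM]
  have hEM : E * M = M := by rw [hcomm, hMGM]
  have hEE : E * E = E := by rw [hE, ← Matrix.mul_assoc, hGMG]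
  have hEH : Eᴴ = E := by rw [hE, conjTranspose_mul, hG.1.eq, hM.eq, ← hcomm]
  have hPN : P * (1 - E) = 0 := by
    rw [← hGG, Matrix.mul_sub, Matrix.mul_one, Matrix.mul_assoc, hGE, sub_self]
  have hXE : X * E = X := by
    have hA' := hA.conjTranspose_mul_mul_same (1 - E)
    have hB' := hB.conjTranspose_mul_mul_same (1 - E)
    have hsum : (1 - E)ᴴ * (P + X) * (1 - E) + (1 - E)ᴴ * (P - X) * (1 - E) = 0 := by
      have : (1 - E)ᴴ * (P + X) * (1 - E) + (1 - E)ᴴ * (P - X) * (1 - E)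
          = (2 : ℂ) • ((1 - E)ᴴ * (P * (1 - E))) := by
        rw [← Matrix.mul_assoc, two_smul]
        noncomm_ring
      rw [this, hPN, Matrix.mul_zero, smul_zero]
    have h0 := mul_eq_zero_of_conj_eq_zero hA (add_eq_zero_left hA' hB' hsum)
    rw [Matrix.add_mul, hPN, zero_add, Matrix.mul_sub, Matrix.mul_one, sub_eq_zero] at h0
    exact h0.symm
  have hEX : E * X = X := by
    have := congrArg conjTranspose hXE
    rwa [conjTranspose_mul, hEH, hX.eq] at this
  set S := M * X * M with hS
  have hSH : S.IsHermitian := by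
    rw [Matrix.IsHermitian, hS, conjTranspose_mul, conjTranspose_mul, hM.eq, hX.eq,
      Matrix.mul_assoc]
  have hES : E * S = S := by rw [hS, ← Matrix.mul_assoc, ← Matrix.mul_assoc, hEM]
  have hSE : S * E = S := by rw [hS, Matrix.mul_assoc, hME]
  have hGSG : G * S * G = X := by
    calc G * S * G = (G * M) * X * (M * G) := by simp only [hS, Matrix.mul_assoc]
      _ = X := by rw [← hcomm, ← hE, hEX, hXE]
  have hGEG : G * E * G = P := by rw [hGE, hGG]
  have hMPM : M * P * M = E := by
    calc M * P * M = (M * G) * (G * M) := by rw [← hGG]; simp only [Matrix.mul_assoc]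
      _ = E := by rw [← hcomm, ← hE, hEE]
  have hplus : (E + S).PosSemidef := by
    have := hA.mul_mul_conjTranspose_same M
    rwa [hM.eq, Matrix.mul_add, Matrix.add_mul, hMPM, ← hS] at this
  have hminus : (E - S).PosSemidef := by
    have := hB.mul_mul_conjTranspose_same M
    rwa [hM.eq, Matrix.mul_sub, Matrix.sub_mul, hMPM, ← hS] at this
  have hpm : (E - S) * (E + S) = E - S * S := by
    rw [Matrix.mul_add, Matrix.sub_mul, Matrix.sub_mul, hEE, hSE, hES]; abel
  have hmp : (E + S) * (E - S) = E - S * S := by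
    rw [Matrix.mul_sub, Matrix.add_mul, Matrix.add_mul, hEE, hSE, hES]; abel
  have hTT : (E - S * S).PosSemidef := by
    have h1 := (hplus.mul_mul_conjTranspose_same (E - S)).add
      (hminus.mul_mul_conjTranspose_same (E + S))
    have h2 := h1.smul hhalf
    rw [hminus.1.eq, hplus.1.eq, hpm, hmp, ← Matrix.mul_add,
      show E - S + (E + S) = (2 : ℂ) • E by module, Matrix.mul_smul, smul_smul,
      Matrix.sub_mul, hEE, Matrix.mul_assoc, hSE] at h2
    simpa using h2
  have key : ∀ T : Matrix (Fin n) (Fin n) ℂ, T.IsHermitian → (G * (T * T) * G).PosSemidef := by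
    intro T hT
    have := posSemidef_conjTranspose_mul_self (T * G)
    rwa [conjTranspose_mul, hT.eq, hG.1.eq, ← Matrix.mul_assoc, Matrix.mul_assoc G T T] at this
  have hQ := hmin ((1 / 2 : ℂ) • (G * (E - S * S) * G)) ?_ ?_ ?_
  · have hzero : E - S * S = 0 := by
      have h1 : G * (E - S * S) * G = 0 := by simpa using hQ
      calc E - S * S = E * (E - S * S) * E := by
            rw [Matrix.mul_sub, Matrix.sub_mul, hEE, hEE, ← Matrix.mul_assoc E S S, hES,
              Matrix.mul_assoc S S E, hSE]
        _ = M * (G * (E - S * S) * G) * M := by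
            nth_rewrite 1 [hcomm]
            simp only [hE, Matrix.mul_assoc]
        _ = 0 := by rw [h1]; simp
    have hSS : S * S = E := (sub_eq_zero.1 hzero).symm
    refine ⟨G, S, hG, hGG, hSH, ?_, hGSG.symm⟩
    rw [hSS]
    refine ⟨hEH, hEE, le_antisymm ?_ ?_⟩
    · rintro _ ⟨v, rfl⟩
      exact ⟨M.mulVec v, by simp [hE]⟩
    · rintro _ ⟨v, rfl⟩
      exact ⟨G.mulVec v, by simp [hEG]⟩
  · refine PosSemidef.smul ?_ hhalf
    have := hTT.mul_mul_conjTranspose_same G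
    rwa [hG.1.eq] at this
  · have := (key (E + S) hplus.1).smul hhalf
    convert this using 1
    rw [Matrix.mul_add (E + S), Matrix.add_mul, Matrix.add_mul, hEE, hSE, hES,
      show E + S + (S + S * S) = (2 : ℂ) • E - (E - S * S) + (2 : ℂ) • S by module,
      Matrix.mul_add G]
    simp only [Matrix.mul_sub G, Matrix.add_mul _ _ G, Matrix.sub_mul _ _ G, Matrix.mul_smul,
      Matrix.smul_mul, hGEG, hGSG]
    module
  · have := (key (E - S) hminus.1).smul hhalf
    convert this using 1
    rw [Matrix.mul_sub (E - S), Matrix.sub_mul, Matrix.sub_mul, hEE, hSE, hES,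
      show E - S - (S - S * S) = (2 : ℂ) • E - (E - S * S) - (2 : ℂ) • S by module,
      Matrix.mul_sub G]
    simp only [Matrix.mul_sub G, Matrix.sub_mul _ _ G, Matrix.mul_smul, Matrix.smul_mul,
      hGEG, hGSG]
    module

lemma vnorm_eq_norm (v : Fin n → ℂ) : vnorm v = ‖WithLp.toLp 2 v‖ := by
  rw [EuclideanSpace.norm_eq]
  rfl

open scoped Matrix.Norms.L2Operator in
lemma opNorm_eq_norm (A : Matrix (Fin n) (Fin n) ℂ) : opNorm A = ‖A‖ := by
  rw [l2_opNorm_def, ← ContinuousLinearMap.sSup_unitClosedBall_eq_norm]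
  unfold opNorm
  congr 1
  ext c
  simp only [Set.mem_ofPred_eq, Set.mem_image, Metric.mem_closedBall, dist_zero_right]
  constructor
  · rintro ⟨v, hv, rfl⟩
    exact ⟨WithLp.toLp 2 v, by rwa [← vnorm_eq_norm], by rw [vnorm_eq_norm]; rfl⟩
  · rintro ⟨v, hv, rfl⟩
    exact ⟨WithLp.ofLp v, by rwa [vnorm_eq_norm], by rw [vnorm_eq_norm]; rfl⟩

open scoped Matrix.Norms.L2Operator in
lemma vnorm_mulVec_le (A : Matrix (Fin n) (Fin n) ℂ) (v : Fin n → ℂ) :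
    vnorm (A *ᵥ v) ≤ opNorm A * vnorm v := by
  rw [opNorm_eq_norm, vnorm_eq_norm, vnorm_eq_norm]
  exact l2_opNorm_mulVec A (WithLp.toLp 2 v)

open scoped Matrix.Norms.L2Operator in
lemma opNorm_hadamard_le (X A : Matrix (Fin n) (Fin n) ℂ) (hA : opNorm A ≤ 1) :
    opNorm (hadamard X A) ≤ schurNorm X := by
  let f : Matrix (Fin n) (Fin n) ℂ →ₗ[ℂ] Matrix (Fin n) (Fin n) ℂ :=
    { toFun := fun B => hadamard X B
      map_add' := fun B C => hadamard_add X B C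
      map_smul' := fun c B => hadamard_smul X B c }
  refine le_csSup ⟨‖LinearMap.toContinuousLinearMap f‖, ?_⟩ ⟨A, hA, rfl⟩
  rintro _ ⟨B, hB, rfl⟩
  rw [opNorm_eq_norm] at hB ⊢
  exact (LinearMap.toContinuousLinearMap f).unit_le_opNorm B hB

lemma schurNorm_nonneg (X : Matrix (Fin n) (Fin n) ℂ) : 0 ≤ schurNorm X := by
  refine Real.sSup_nonneg ?_
  rintro _ ⟨A, -, rfl⟩
  refine Real.sSup_nonneg ?_
  rintro _ ⟨v, -, rfl⟩
  exact Real.sqrt_nonneg _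

open scoped Matrix.Norms.L2Operator in
lemma opNorm_le_one_of_unitary {U : Matrix (Fin n) (Fin n) ℂ} (hU : Uᴴ * U = 1) :
    opNorm U ≤ 1 := by
  rw [opNorm_eq_norm]
  have h := l2_opNorm_conjTranspose_mul_self U
  rw [hU] at h
  rcases isEmpty_or_nonempty (Fin n) with hn | hn
  · rw [Subsingleton.elim U 0, norm_zero]
    exact zero_le_one
  · rw [CStarRing.norm_one] at h
    nlinarith [norm_nonneg U]

lemma norm_dotProduct_le (u v : Fin n → ℂ) : ‖star u ⬝ᵥ v‖ ≤ vnorm u * vnorm v := by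
  rw [vnorm_eq_norm, vnorm_eq_norm, dotProduct_comm]
  exact norm_inner_le_norm (𝕜 := ℂ) (WithLp.toLp 2 u) (WithLp.toLp 2 v)

/-- A Hermitian matrix `Y` has a majorant of `± Y` whose trace is attained by pairing `Y` with
a unitary. -/
lemma exists_abs {Y : Matrix (Fin n) (Fin n) ℂ} (hY : Y.IsHermitian) :
    ∃ R U : Matrix (Fin n) (Fin n) ℂ, (R + Y).PosSemidef ∧ (R - Y).PosSemidef ∧
      Uᴴ * U = 1 ∧ U * Uᴴ = 1 ∧ R.trace = (Y * U).trace := by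
  obtain ⟨Q, hQ, hQ', hYQ⟩ := exists_unitary_diagonal hY
  set c := hY.eigenvalues
  set σ : Fin n → ℝ := fun i => if 0 ≤ c i then 1 else -1 with hσ
  have hcσ : ∀ i, c i * σ i = |c i| := by
    intro i
    simp only [hσ]
    split_ifs with h
    · rw [abs_of_nonneg h, mul_one]
    · rw [abs_of_neg (not_le.1 h), mul_neg_one]
  have hσσ : ∀ i, σ i * σ i = 1 := by
    intro i
    simp only [hσ]
    split_ifs <;> norm_num
  set U := Q * diagonal (fun i => (σ i : ℂ)) * Qᴴ with hU
  have hUH : Uᴴ = U := by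
    refine isHermitian_mul_mul_conjTranspose Q (isHermitian_diagonal_of_self_adjoint _ ?_)
    ext i
    simp
  have hUU : U * U = 1 := by
    rw [hU, conj_mul_conj hQ, diagonal_mul_diagonal]
    have : (fun i => (σ i : ℂ) * σ i) = fun _ => 1 := by
      ext i
      exact_mod_cast hσσ i
    rw [this, diagonal_one, Matrix.mul_one, hQ']
  have hR : Q * diagonal (fun i => ((|c i| : ℝ) : ℂ)) * Qᴴ = Y * U := by
    rw [hU]
    conv_rhs => rw [hYQ]
    rw [conj_mul_conj hQ, diagonal_mul_diagonal]
    congr 3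
    ext i
    rw [← Complex.ofReal_mul, hcσ]
  refine ⟨Q * diagonal (fun i => ((|c i| : ℝ) : ℂ)) * Qᴴ, U, ?_, ?_, ?_, ?_, ?_⟩
  · conv in _ + Y => rw [hYQ]
    rw [← Matrix.add_mul, ← Matrix.mul_add, diagonal_add]
    refine PosSemidef.mul_mul_conjTranspose_same (PosSemidef.diagonal fun i => ?_) Q
    have : 0 ≤ |c i| + c i := by linarith [neg_abs_le (c i)]
    exact (Complex.zero_le_real.2 this).trans_eq (Complex.ofReal_add _ _)
  · conv in _ - Y => rw [hYQ]
    rw [← Matrix.sub_mul, ← Matrix.mul_sub, diagonal_sub]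
    refine PosSemidef.mul_mul_conjTranspose_same (PosSemidef.diagonal fun i => ?_) Q
    have : 0 ≤ |c i| - c i := by linarith [le_abs_self (c i)]
    exact (Complex.zero_le_real.2 this).trans_eq (Complex.ofReal_sub _ _)
  · rw [hUH, hUU]
  · rw [hUH, hUU]
  · rw [hR]

/-- For strictly positive weights there is a majorant of `± X` whose weighted trace is controlled
by the Schur norm. -/
lemma exists_majorant_weighted {X : Matrix (Fin n) (Fin n) ℂ} (hX : X.IsHermitian)
    (w : Fin n → ℝ) (hw : ∀ i, 0 < w i) :
    ∃ P : Matrix (Fin n) (Fin n) ℂ, (P + X).PosSemidef ∧ (P - X).PosSemidef ∧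
      ∑ i, w i * (P i i).re ≤ schurNorm X * ∑ i, w i := by
  set d : Fin n → ℂ := fun i => (√(w i) : ℂ) with hd
  have hd0 : ∀ i, d i ≠ 0 := fun i => by
    simpa [hd] using (Real.sqrt_pos.2 (hw i)).ne'
  have hdd : ∀ i, d i * d i = w i := fun i => by
    simp only [hd]
    rw [← Complex.ofReal_mul, Real.mul_self_sqrt (hw i).le]
  have hstar : star d = d := by
    ext i
    simp [hd]
  have hDH : (diagonal d)ᴴ = diagonal d := by rw [diagonal_conjTranspose, hstar]
  set D' : Matrix (Fin n) (Fin n) ℂ := diagonal (fun i => (d i)⁻¹) with hD'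
  have hD'H : D'ᴴ = D' := by
    rw [hD', diagonal_conjTranspose]
    congr 1
    ext i
    simp [hd]
  have hY : (diagonal d * X * diagonal d).IsHermitian := by
    have := isHermitian_mul_mul_conjTranspose (diagonal d) hX
    rwa [hDH] at this
  obtain ⟨R, U, hp, hm, hU, hU', htr⟩ := exists_abs hY
  have hDX : D' * (diagonal d * X * diagonal d) * D' = X := by
    ext i j
    simp only [hD', mul_diagonal, diagonal_mul]
    field_simp [hd0 i, hd0 j]
  refine ⟨D' * R * D', ?_, ?_, ?_⟩
  · have := hp.mul_mul_conjTranspose_same D'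
    rwa [hD'H, Matrix.mul_add, Matrix.add_mul, hDX] at this
  · have := hm.mul_mul_conjTranspose_same D'
    rwa [hD'H, Matrix.mul_sub, Matrix.sub_mul, hDX] at this
  · have hsum : ((∑ i, w i * ((D' * R * D') i i).re : ℝ) : ℂ).re = R.trace.re := by
      rw [Complex.ofReal_re, trace, Complex.re_sum]
      refine Finset.sum_congr rfl fun i _ => ?_
      have : (w i : ℂ) * (D' * R * D') i i = R i i := by
        rw [← hdd i]
        simp only [hD', mul_diagonal, diagonal_mul]
        field_simp [hd0 i]
      rw [diag_apply, ← this, Complex.re_ofReal_mul]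
    rw [Complex.ofReal_re] at hsum
    have hpair : R.trace = star d ⬝ᵥ (hadamard X Uᵀ *ᵥ d) := by
      rw [htr, hstar]
      simp only [trace, diag_apply, mul_apply, dotProduct, mulVec,
        hadamard_apply, transpose_apply, Finset.mul_sum]
      refine Finset.sum_congr rfl fun i _ => Finset.sum_congr rfl fun j _ => ?_
      simp only [diagonal_apply, mul_ite, mul_zero, ite_mul, zero_mul, Finset.sum_ite_eq,
        Finset.sum_ite_eq', Finset.mem_univ, if_true]
      ring
    have hUT : opNorm Uᵀ ≤ 1 := by
      refine opNorm_le_one_of_unitary ?_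
      have := congrArg transpose hU'
      rwa [transpose_mul, transpose_one] at this
    have hvd : vnorm d * vnorm d = ∑ i, w i := by
      unfold vnorm
      rw [Real.mul_self_sqrt (Finset.sum_nonneg fun i _ => sq_nonneg _)]
      refine Finset.sum_congr rfl fun i _ => ?_
      simp [hd, Real.sq_sqrt (hw i).le]
    have hv0 : 0 ≤ vnorm d := Real.sqrt_nonneg _
    calc ∑ i, w i * ((D' * R * D') i i).re = R.trace.re := hsum
      _ ≤ ‖R.trace‖ := Complex.re_le_norm _
      _ ≤ vnorm d * vnorm (hadamard X Uᵀ *ᵥ d) := by rw [hpair]; exact norm_dotProduct_le _ _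
      _ ≤ vnorm d * (schurNorm X * vnorm d) := by
        gcongr
        refine (vnorm_mulVec_le _ _).trans ?_
        gcongr
        exact opNorm_hadamard_le X _ hUT
      _ = schurNorm X * (vnorm d * vnorm d) := by ring
      _ = schurNorm X * ∑ i, w i := by rw [hvd]

/-- The majorants of `± X` all of whose diagonal entries are at most `μ`. -/
def majorants (X : Matrix (Fin n) (Fin n) ℂ) (μ : ℝ) : Set (Matrix (Fin n) (Fin n) ℂ) :=
  {P | (P + X).PosSemidef ∧ (P - X).PosSemidef ∧ ∀ i, (P i i).re ≤ μ}

lemma re_diag_nonneg {P : Matrix (Fin n) (Fin n) ℂ} (hP : P.PosSemidef) (i : Fin n) :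
    0 ≤ (P i i).re :=
  (Complex.le_def.1 (hP.diag_nonneg (i := i))).1

lemma posSemidef_convex_comb {A B : Matrix (Fin n) (Fin n) ℂ} (hA : A.PosSemidef)
    (hB : B.PosSemidef) {a b : ℝ} (ha : 0 ≤ a) (hb : 0 ≤ b) : (a • A + b • B).PosSemidef :=
  (hA.smul ha).add (hB.smul hb)

lemma majorants_nonempty_of_lt {X : Matrix (Fin n) (Fin n) ℂ} (hX : X.IsHermitian) {μ : ℝ}
    (hμ : schurNorm X < μ) : (majorants X μ).Nonempty := by
  set t : Set (Fin n → ℝ) := {d | ∃ P : Matrix (Fin n) (Fin n) ℂ, (P + X).PosSemidef ∧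
    (P - X).PosSemidef ∧ ∀ i, (P i i).re ≤ d i} with ht
  set s : Set (Fin n → ℝ) := Set.univ.pi fun _ => Set.Iio μ with hs
  by_cases hdisj : Disjoint s t
  swap
  · obtain ⟨d, hds, P, hp, hm, hd⟩ := Set.not_disjoint_iff.1 hdisj
    exact ⟨P, hp, hm, fun i => (hd i).trans (hds i trivial).le⟩
  exfalso
  have ht_conv : Convex ℝ t := by
    rintro d ⟨P, hp, hm, hd⟩ d' ⟨P', hp', hm', hd'⟩ a b ha hb hab
    refine ⟨a • P + b • P', ?_, ?_, fun i => ?_⟩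
    · convert posSemidef_convex_comb hp hp' ha hb using 1
      have hXab : X = a • X + b • X := by rw [← add_smul, hab, one_smul]
      nth_rewrite 1 [hXab]
      module
    · convert posSemidef_convex_comb hm hm' ha hb using 1
      have hXab : X = a • X + b • X := by rw [← add_smul, hab, one_smul]
      nth_rewrite 1 [hXab]
      module
    · simp only [Matrix.add_apply, Matrix.smul_apply, Complex.add_re, Complex.smul_re,
        Pi.add_apply, Pi.smul_apply, smul_eq_mul]
      gcongr
      · exact hd i
      · exact hd' i
  obtain ⟨f, u, hfs, hft⟩ := geometric_hahn_banach_open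
    (convex_pi fun _ _ => convex_Iio μ) (isOpen_set_pi Set.finite_univ fun _ _ => isOpen_Iio)
    ht_conv hdisj
  set w : Fin n → ℝ := fun i => f (Pi.single i 1) with hw
  have hf : ∀ d : Fin n → ℝ, f d = ∑ i, w i * d i := by
    intro d
    conv_lhs => rw [← Finset.univ_sum_single d, map_sum]
    refine Finset.sum_congr rfl fun i _ => ?_
    rw [hw, mul_comm, ← smul_eq_mul, ← map_smul, ← Pi.single_smul, smul_eq_mul, mul_one]
  have hw0 : ∀ i, 0 ≤ w i := by
    intro i
    obtain ⟨P, hp, hm, -⟩ := exists_majorant_weighted hX 1 (fun _ => one_pos)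
    by_contra! hneg
    set a : Fin n → ℝ := fun j => (P j j).re with ha
    obtain ⟨k, hk⟩ := exists_nat_gt ((f a - u) / -w i)
    have hmem : a + (k : ℝ) • Pi.single i 1 ∈ t := by
      refine ⟨P, hp, hm, fun j => ?_⟩
      have : (0 : ℝ) ≤ ((k : ℝ) • (Pi.single i 1 : Fin n → ℝ)) j := by
        by_cases h : j = i
        · subst h; simp
        · simp [h]
      simp only [Pi.add_apply, ha]
      linarith
    have h1 := hft _ hmem
    rw [map_add, map_smul, smul_eq_mul] at h1
    rw [div_lt_iff₀ (by linarith)] at hk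
    change u ≤ f a + k * w i at h1
    linarith
  have hu : u ≤ schurNorm X * ∑ i, w i := by
    refine le_of_forall_pos_le_add fun ε hε => ?_
    have hden : 0 < schurNorm X * n + 1 := by
      have := schurNorm_nonneg X
      positivity
    set δ := ε / (schurNorm X * n + 1) with hδ
    have hδ0 : 0 < δ := div_pos hε hden
    obtain ⟨P, hp, hm, hP⟩ := exists_majorant_weighted hX (fun i => w i + δ)
      (fun i => add_pos_of_nonneg_of_pos (hw0 i) hδ0)
    have hPpos := posSemidef_of_majorant hp hm
    have h1 : u ≤ ∑ i, w i * (P i i).re := by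
      rw [← hf]
      exact hft _ ⟨P, hp, hm, fun i => le_rfl⟩
    have h2 : ∑ i, w i * (P i i).re ≤ ∑ i, (w i + δ) * (P i i).re := by
      refine Finset.sum_le_sum fun i _ => ?_
      have := re_diag_nonneg hPpos i
      gcongr
      linarith
    have h3 : schurNorm X * ∑ i, (w i + δ) = schurNorm X * ∑ i, w i + schurNorm X * n * δ := by
      rw [Finset.sum_add_distrib]
      simp
      ring
    have h4 : (schurNorm X * n + 1) * δ = ε := mul_div_cancel₀ _ hden.ne'
    linarith
  obtain ⟨ν, hν, hνμ⟩ := exists_between hμ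
  have h1 : f (fun _ => ν) < u := hfs _ fun _ _ => hνμ
  rw [hf, ← Finset.sum_mul, mul_comm] at h1
  have h2 : schurNorm X * ∑ i, w i ≤ ν * ∑ i, w i := by
    gcongr
    exact Finset.sum_nonneg fun i _ => hw0 i
  linarith

lemma isClosed_posSemidef : IsClosed {P : Matrix (Fin n) (Fin n) ℂ | P.PosSemidef} := by
  simp only [posSemidef_iff_dotProduct_mulVec, Set.ofPred_and, Set.ofPred_forall]
  refine IsClosed.inter ?_ (isClosed_iInter fun x => ?_)
  · exact isClosed_eq continuous_id.matrix_conjTranspose continuous_id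
  · have hc : Continuous fun P : Matrix (Fin n) (Fin n) ℂ => star x ⬝ᵥ (P *ᵥ x) := by fun_prop
    exact isClosed_Ici.preimage hc

lemma re_mul_self_diag {G : Matrix (Fin n) (Fin n) ℂ} (hG : G.IsHermitian) (j : Fin n) :
    ((G * G) j j).re = ∑ k, ‖G k j‖ ^ 2 := by
  nth_rewrite 1 [← hG.eq]
  rw [mul_apply, Complex.re_sum]
  refine Finset.sum_congr rfl fun k _ => ?_
  rw [conjTranspose_apply, Complex.star_def, ← Complex.normSq_eq_conj_mul_self,
    Complex.ofReal_re, Complex.normSq_eq_norm_sq]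

lemma isCompact_majorants (X : Matrix (Fin n) (Fin n) ℂ) (μ : ℝ) :
    IsCompact (majorants X μ) := by
  have hclosed : IsClosed (majorants X μ) := by
    refine IsClosed.inter (isClosed_posSemidef.preimage (continuous_id.add continuous_const))
      (IsClosed.inter (isClosed_posSemidef.preimage (continuous_id.sub continuous_const)) ?_)
    have hdiag : IsClosed (⋂ i, {P : Matrix (Fin n) (Fin n) ℂ | (P i i).re ≤ μ}) := by
      refine isClosed_iInter fun i => isClosed_le ?_ continuous_const
      exact Complex.continuous_re.comp (continuous_id.matrix_elem i i)
    rwa [← Set.ofPred_forall] at hdiag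
  set C : Set (Matrix (Fin n) (Fin n) ℂ) :=
    Set.univ.pi fun _ => Set.univ.pi fun _ => Metric.closedBall 0 (√μ) with hC
  have hCc : IsCompact C := isCompact_univ_pi fun _ => isCompact_univ_pi fun _ =>
    isCompact_closedBall _ _
  have hcont : Continuous fun B : Matrix (Fin n) (Fin n) ℂ => Bᴴ * B := by fun_prop
  refine (hCc.image hcont).of_isClosed_subset hclosed ?_
  rintro P ⟨hp, hm, hd⟩
  obtain ⟨G, -, hG, -, hGG, -⟩ := exists_sqrt_pinv (posSemidef_of_majorant hp hm)
  refine ⟨G, fun i _ j _ => ?_, by rw [← hGG]; simp only [hG.1.eq]⟩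
  rw [mem_closedBall_zero_iff]
  refine Real.le_sqrt_of_sq_le ?_
  calc ‖G i j‖ ^ 2 ≤ ∑ k, ‖G k j‖ ^ 2 :=
        Finset.single_le_sum (f := fun k => ‖G k j‖ ^ 2) (fun k _ => sq_nonneg _)
          (Finset.mem_univ i)
    _ ≤ μ := by rw [← re_mul_self_diag hG.1, hGG]; exact hd j

lemma majorants_nonempty {X : Matrix (Fin n) (Fin n) ℂ} (hX : X.IsHermitian) :
    (majorants X (schurNorm X)).Nonempty := by
  have hmono : ∀ {a b : ℝ}, a ≤ b → majorants X a ⊆ majorants X b :=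
    fun hab P hP => ⟨hP.1, hP.2.1, fun i => (hP.2.2 i).trans hab⟩
  obtain ⟨P, hP⟩ := IsCompact.nonempty_iInter_of_sequence_nonempty_isCompact_isClosed
    (fun k : ℕ => majorants X (schurNorm X + 1 / ((k : ℝ) + 1)))
    (fun k => hmono (by gcongr; simp))
    (fun k => majorants_nonempty_of_lt hX (by linarith [Nat.one_div_pos_of_nat (α := ℝ) (n := k)]))
    (isCompact_majorants X _) (fun k => (isCompact_majorants X _).isClosed)
  rw [Set.mem_iInter] at hP
  refine ⟨P, (hP 0).1, (hP 0).2.1, fun i => ?_⟩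
  refine ge_of_tendsto' (x := Filter.atTop) (f := fun k : ℕ => schurNorm X + 1 / ((k : ℝ) + 1))
    ?_ fun k => (hP k).2.2 i
  simpa using (tendsto_one_div_add_atTop_nhds_zero_nat (𝕜 := ℝ)).const_add (schurNorm X)

/-- A trace-minimal majorant of `± X` with diagonal bounded by the Schur norm. -/
lemma exists_minimal_majorant {X : Matrix (Fin n) (Fin n) ℂ} (hX : X.IsHermitian) :
    ∃ P ∈ majorants X (schurNorm X), ∀ Q : Matrix (Fin n) (Fin n) ℂ, Q.PosSemidef →
      (P - Q + X).PosSemidef → (P - Q - X).PosSemidef → Q = 0 := by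
  have hcont : Continuous fun P : Matrix (Fin n) (Fin n) ℂ => P.trace.re :=
    Complex.continuous_re.comp continuous_id.matrix_trace
  obtain ⟨P, hP, hmin⟩ := (isCompact_majorants X (schurNorm X)).exists_isMinOn
    (majorants_nonempty hX) hcont.continuousOn
  refine ⟨P, hP, fun Q hQ hp hm => ?_⟩
  have hmem : P - Q ∈ majorants X (schurNorm X) := by
    refine ⟨hp, hm, fun i => ?_⟩
    have := re_diag_nonneg hQ i
    have := hP.2.2 i
    rw [Matrix.sub_apply, Complex.sub_re]
    linarith
  have h1 : P.trace.re ≤ (P - Q).trace.re := hmin hmem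
  rw [trace_sub, Complex.sub_re] at h1
  have h2 := Complex.le_def.1 hQ.trace_nonneg
  rw [← hQ.trace_eq_zero_iff]
  refine Complex.ext ?_ h2.2.symm
  have := h2.1
  rw [Complex.zero_re] at this ⊢
  linarith

lemma vnorm_col_eq_sqrt {G : Matrix (Fin n) (Fin n) ℂ} (hG : G.IsHermitian) (j : Fin n) :
    vnorm (fun i => G i j) = √((G * G) j j).re := by
  rw [re_mul_self_diag hG]
  rfl

lemma ran_smul {c : ℂ} (hc : c ≠ 0) (G : Matrix (Fin n) (Fin n) ℂ) : ran (c • G) = ran G := by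
  refine le_antisymm ?_ ?_
  · rintro _ ⟨v, rfl⟩
    exact ⟨c • v, by simp⟩
  · rintro _ ⟨v, rfl⟩
    exact ⟨c⁻¹ • v, by simp [smul_smul, hc]⟩

theorem stmt3 {n : ℕ} (X : Matrix (Fin n) (Fin n) ℂ) (hX : X.IsHermitian) :
    ∃ G S : Matrix (Fin n) (Fin n) ℂ, G.PosSemidef ∧ colNorm G ≤ 1 ∧
      S.IsHermitian ∧ IsOrthProjOnto (S * S) (ran G) ∧
      X = (schurNorm X : ℂ) • (G * S * G) := by
  obtain ⟨P, ⟨hp, hm, hd⟩, hmin⟩ := exists_minimal_majorant hX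
  obtain ⟨G, S, hG, hGG, hS, hSG, hXG⟩ := exists_symmetry_of_minimal hX hp hm hmin
  have hcol : ∀ j, vnorm (fun i => G i j) ≤ √(schurNorm X) := fun j => by
    rw [vnorm_col_eq_sqrt hG.1, hGG]
    exact Real.sqrt_le_sqrt (hd j)
  rcases (schurNorm_nonneg X).eq_or_lt with h0 | hpos
  · rw [← h0, Real.sqrt_zero] at hcol
    have hG0 : G = 0 := by
      ext i j
      have h1 : vnorm (fun i => G i j) = 0 := le_antisymm (hcol j) (Real.sqrt_nonneg _)
      rw [vnorm_eq_norm, norm_eq_zero] at h1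
      exact congrFun (congrArg WithLp.ofLp h1) i
    refine ⟨G, S, hG, Real.iSup_le (fun j => (hcol j).trans zero_le_one) zero_le_one, hS, hSG, ?_⟩
    rw [hXG, hG0]
    simp
  · set r := √(schurNorm X) with hr
    have hr0 : 0 < r := Real.sqrt_pos.2 hpos
    have hrr : r * r = schurNorm X := Real.mul_self_sqrt hpos.le
    have hrC : (r : ℂ) ≠ 0 := Complex.ofReal_ne_zero.2 hr0.ne'
    refine ⟨(r : ℂ)⁻¹ • G, S, hG.smul ?_, Real.iSup_le (fun j => ?_) zero_le_one, hS, ?_, ?_⟩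
    · rw [← Complex.ofReal_inv]
      exact Complex.zero_le_real.2 (inv_nonneg.2 hr0.le)
    · have h1 : vnorm (fun i => ((r : ℂ)⁻¹ • G) i j) = r⁻¹ * vnorm (fun i => G i j) := by
        rw [vnorm_eq_norm, vnorm_eq_norm]
        have := norm_smul (r : ℂ)⁻¹ (WithLp.toLp 2 (fun i => G i j))
        rw [norm_inv, Complex.norm_real, Real.norm_of_nonneg hr0.le] at this
        exact this
      rw [h1, inv_mul_le_iff₀ hr0, mul_one]
      exact hcol j
    · rwa [ran_smul (inv_ne_zero hrC)]
    · rw [Matrix.smul_mul, Matrix.smul_mul, Matrix.mul_smul, ← hXG, smul_smul, smul_smul, ← hrr,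
        Complex.ofReal_mul]
      field_simp
      simp

end MatFact
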